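/- arXiv:1711.05545 — 2 statements merged into one kernel-verified Lean document; each statement's English description precedes it below -/
import Mathlib

section
/- Let G be a finite group acting ℚ-linearly on a finite-dimensional ℚ-vector space V, and let U be a G-invariant ℂ-subspace of V ⊗_ℚ ℂ (for the ℂ-linear extension of the G-action) such that V ⊗_ℚ ℂ is the internal direct sum of U and σ(U). If the only ℂ-linear map f : σ(U) → U commuting with the action of every element of G is the zero map, then the Hodge structure (V, U) admits a polarization. -/
open scoped TensorProduct

noncomputable section

instance : RingHomSurjective (starRingEnd ℂ) :=
  ⟨fun z => ⟨star z, by simp⟩⟩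

/-- Complex conjugation as a `ℚ`-linear map on `ℂ`. -/
def conjQLin : ℂ →ₗ[ℚ] ℂ where
  toFun z := (starRingEnd ℂ) z
  map_add' := by intros; simp
  map_smul' := by intro q z; simp [Rat.smul_def, map_mul]

/-- The antilinear involution `σ` on `ℂ ⊗[ℚ] V` determined by conjugation on the
first factor, packaged as a `starRingEnd ℂ`-semilinear map. -/
def sigmaV (V : Type*) [AddCommGroup V] [Module ℚ V] :
    (ℂ ⊗[ℚ] V) →ₛₗ[starRingEnd ℂ] (ℂ ⊗[ℚ] V) where
  toFun := TensorProduct.map conjQLin LinearMap.id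
  map_add' := map_add _
  map_smul' c x := by
    induction x using TensorProduct.induction_on with
    | zero => simp
    | tmul z v =>
        simp [TensorProduct.smul_tmul', smul_eq_mul, conjQLin, map_mul]
    | add x y hx hy =>
        simp only [smul_add, map_add]
        exact congrArg₂ (· + ·) hx hy

/-- `σ(U)`, the image of a `ℂ`-subspace `U` of `ℂ ⊗[ℚ] V` under the conjugation
involution; it is again a `ℂ`-subspace. -/
def sigmaSub {V : Type*} [AddCommGroup V] [Module ℚ V]
    (U : Submodule ℂ (ℂ ⊗[ℚ] V)) : Submodule ℂ (ℂ ⊗[ℚ] V) :=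
  U.map (sigmaV V)

/-- A `ℂ`-linear map `f : P → Q` between subspaces of `ℂ ⊗[ℚ] V` commutes with an
operator `T` of the ambient space. -/
def CommutesWith {V : Type*} [AddCommGroup V] [Module ℚ V]
    (P Q : Submodule ℂ (ℂ ⊗[ℚ] V)) (f : P →ₗ[ℂ] Q)
    (T : (ℂ ⊗[ℚ] V) →ₗ[ℂ] (ℂ ⊗[ℚ] V)) : Prop :=
  ∀ (x : P) (hx : T ↑x ∈ P), (f ⟨T ↑x, hx⟩ : ℂ ⊗[ℚ] V) = T ↑(f x)

/-- `E` is a polarization of the weight-one rational Hodge structure `(V, U)`: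
it is alternating, its `ℂ`-bilinear extension vanishes on `U × U`, and
`-i·E_ℂ(u, σ u)` is a positive real for every nonzero `u ∈ U`. -/
def IsPolarization {V : Type*} [AddCommGroup V] [Module ℚ V]
    (U : Submodule ℂ (ℂ ⊗[ℚ] V)) (E : V →ₗ[ℚ] V →ₗ[ℚ] ℚ) : Prop :=
  (∀ x : V, E x x = 0) ∧
  (∀ u ∈ U, ∀ u' ∈ U, LinearMap.BilinForm.baseChange ℂ E u u' = 0) ∧
  (∀ u ∈ U, u ≠ 0 → ∃ r : ℝ, 0 < r ∧
    -Complex.I * LinearMap.BilinForm.baseChange ℂ E u (sigmaV V u) = (r : ℂ))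


section Conjugation

variable {V : Type*} [AddCommGroup V] [Module ℚ V]

@[simp]
lemma sigmaV_tmul (z : ℂ) (v : V) :
    sigmaV V (z ⊗ₜ[ℚ] v) = (starRingEnd ℂ z) ⊗ₜ[ℚ] v := rfl

@[simp]
lemma sigmaV_sigmaV (x : ℂ ⊗[ℚ] V) : sigmaV V (sigmaV V x) = x := by
  induction x using TensorProduct.induction_on with
  | zero => simp
  | tmul z v => simp
  | add x y hx hy => simp [hx, hy]

lemma sigmaV_baseChange (T : V →ₗ[ℚ] V) (x : ℂ ⊗[ℚ] V) :
    sigmaV V (T.baseChange ℂ x) = T.baseChange ℂ (sigmaV V x) := by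
  induction x using TensorProduct.induction_on with
  | zero => simp
  | tmul z v => simp
  | add x y hx hy => simp [hx, hy]

lemma bilinForm_baseChange_sigmaV (B : LinearMap.BilinForm ℚ V) (x y : ℂ ⊗[ℚ] V) :
    LinearMap.BilinForm.baseChange ℂ B (sigmaV V x) (sigmaV V y) =
      starRingEnd ℂ (LinearMap.BilinForm.baseChange ℂ B x y) := by
  induction x using TensorProduct.induction_on with
  | zero => simp
  | add x x' hx hx' => simp [hx, hx']
  | tmul z v =>
    induction y using TensorProduct.induction_on with
    | zero => simp
    | add y y' hy hy' => simp only [map_add, hy, hy']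
    | tmul w v' => simp [LinearMap.BilinForm.baseChange_tmul, Algebra.smul_def]

lemma baseChange_sub_flip (B : LinearMap.BilinForm ℚ V) (x y : ℂ ⊗[ℚ] V) :
    LinearMap.BilinForm.baseChange ℂ (B - B.flip : LinearMap.BilinForm ℚ V) x y =
      LinearMap.BilinForm.baseChange ℂ B x y - LinearMap.BilinForm.baseChange ℂ B y x := by
  induction x using TensorProduct.induction_on with
  | zero => simp
  | add x x' hx hx' =>
    simp only [map_add, LinearMap.add_apply, hx, hx']
    ring
  | tmul z v =>
    induction y using TensorProduct.induction_on with
    | zero => simp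
    | add y y' hy hy' =>
      simp only [map_add, LinearMap.add_apply, hy, hy']
      ring
    | tmul w v' =>
      simp only [LinearMap.BilinForm.baseChange_tmul, LinearMap.sub_apply, LinearMap.BilinForm.flip_apply,
        sub_smul, mul_comm z w]

lemma sigmaV_mem_sigmaSub {U : Submodule ℂ (ℂ ⊗[ℚ] V)} {x : ℂ ⊗[ℚ] V} (hx : x ∈ U) :
    sigmaV V x ∈ sigmaSub U :=
  Submodule.mem_map_of_mem hx

lemma sigmaV_mem_of_mem_sigmaSub {U : Submodule ℂ (ℂ ⊗[ℚ] V)} {x : ℂ ⊗[ℚ] V}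
    (hx : x ∈ sigmaSub U) : sigmaV V x ∈ U := by
  obtain ⟨u, hu, rfl⟩ := Submodule.mem_map.1 hx
  simpa using hu

lemma sigmaV_projection {U : Submodule ℂ (ℂ ⊗[ℚ] V)} (h : IsCompl U (sigmaSub U))
    (x : ℂ ⊗[ℚ] V) :
    sigmaV V (U.projection (sigmaSub U) h x) = (sigmaSub U).projection U h.symm (sigmaV V x) := by
  have hdecomp := Submodule.projection_add_projection_eq_self h x
  conv_rhs => rw [← hdecomp, map_add, map_add]
  rw [Submodule.projection_apply_of_mem_left _
      (sigmaV_mem_sigmaSub (Submodule.projection_apply_mem h x)),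
    Submodule.projection_apply_of_mem_right _
      (sigmaV_mem_of_mem_sigmaSub (Submodule.projection_apply_mem h.symm x)), add_zero]

lemma sigmaV_basis {ι : Type*} (b : Module.Basis ι ℚ V) (i : ι) :
    sigmaV V (b.baseChange ℂ i) = b.baseChange ℂ i := by
  simp

lemma repr_sigmaV {ι : Type*} (b : Module.Basis ι ℚ V) (x : ℂ ⊗[ℚ] V) (i : ι) :
    (b.baseChange ℂ).repr (sigmaV V x) i = starRingEnd ℂ ((b.baseChange ℂ).repr x i) := by
  induction x using TensorProduct.induction_on with
  | zero => simp
  | tmul z v => simp [Algebra.smul_def]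
  | add x y hx hy => simp [hx, hy]

lemma baseChange_toBilin {ι : Type*} [Fintype ι] [DecidableEq ι] (b : Module.Basis ι ℚ V)
    (M : Matrix ι ι ℚ) :
    LinearMap.BilinForm.baseChange ℂ (Matrix.toBilin b M) =
      Matrix.toBilin (b.baseChange ℂ) (M.map (fun q : ℚ => (q : ℂ))) := by
  refine LinearMap.BilinForm.ext_basis (b.baseChange ℂ) fun i j => ?_
  rw [← LinearMap.BilinForm.toMatrix_apply (b.baseChange ℂ) (Matrix.toBilin _ _),
    LinearMap.BilinForm.toMatrix_toBilin]
  have h : Matrix.toBilin b M (b i) (b j) = M i j := by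
    rw [← LinearMap.BilinForm.toMatrix_apply, LinearMap.BilinForm.toMatrix_toBilin]
  simp [LinearMap.BilinForm.baseChange_tmul, h, Algebra.smul_def]

/-- A complex bilinear form which is compatible with conjugation has a real Gram matrix in a
rational basis. -/
lemma eq_toBilin_of_conj {ι : Type*} [Fintype ι] [DecidableEq ι] (b : Module.Basis ι ℚ V)
    (B : LinearMap.BilinForm ℂ (ℂ ⊗[ℚ] V))
    (hB : ∀ x y, B (sigmaV V x) (sigmaV V y) = starRingEnd ℂ (B x y)) :
    ∃ M : Matrix ι ι ℝ, Matrix.toBilin (b.baseChange ℂ) (M.map (fun r : ℝ => (r : ℂ))) = B := by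
  refine ⟨fun i j => (B (b.baseChange ℂ i) (b.baseChange ℂ j)).re, ?_⟩
  refine LinearMap.BilinForm.ext_basis (b.baseChange ℂ) fun i j => ?_
  rw [← LinearMap.BilinForm.toMatrix_apply (b.baseChange ℂ) (Matrix.toBilin _ _),
    LinearMap.BilinForm.toMatrix_toBilin]
  have h := hB (b.baseChange ℂ i) (b.baseChange ℂ j)
  rw [sigmaV_basis, sigmaV_basis] at h
  exact Complex.conj_eq_iff_re.1 h.symm

end Conjugation

section Representation

variable {G : Type*} [Group G] {V : Type*} [AddCommGroup V] [Module ℚ V]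

lemma baseChange_rep_mul (ρ : G →* (V →ₗ[ℚ] V)) (g h : G) (x : ℂ ⊗[ℚ] V) :
    (ρ g).baseChange ℂ ((ρ h).baseChange ℂ x) = (ρ (g * h)).baseChange ℂ x := by
  rw [map_mul, Module.End.mul_eq_comp, LinearMap.baseChange_comp, LinearMap.comp_apply]

lemma baseChange_rep_one (ρ : G →* (V →ₗ[ℚ] V)) (x : ℂ ⊗[ℚ] V) :
    (ρ 1).baseChange ℂ x = x := by
  rw [map_one, Module.End.one_eq_id, LinearMap.baseChange_id, LinearMap.id_apply]

lemma baseChange_rep_ne_zero (ρ : G →* (V →ₗ[ℚ] V)) (g : G) {x : ℂ ⊗[ℚ] V} (hx : x ≠ 0) :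
    (ρ g).baseChange ℂ x ≠ 0 := by
  intro h
  apply hx
  rw [← baseChange_rep_one ρ x, ← inv_mul_cancel g, ← baseChange_rep_mul, h, map_zero]

end Representation

section Average

variable {G : Type*} [Group G] [Fintype G] {V : Type*} [AddCommGroup V] [Module ℚ V]

/-- The sum of the translates of a bilinear form under a finite group action. -/
def sumTranslates (ρ : G →* (V →ₗ[ℚ] V)) (B : LinearMap.BilinForm ℚ V) :
    LinearMap.BilinForm ℚ V :=
  ∑ g, B.compl₁₂ (ρ g) (ρ g)

lemma sumTranslates_apply (ρ : G →* (V →ₗ[ℚ] V)) (B : LinearMap.BilinForm ℚ V) (x y : V) :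
    sumTranslates ρ B x y = ∑ g, B (ρ g x) (ρ g y) := by
  simp [sumTranslates, LinearMap.sum_apply]

lemma baseChange_sumTranslates (ρ : G →* (V →ₗ[ℚ] V)) (B : LinearMap.BilinForm ℚ V)
    (x y : ℂ ⊗[ℚ] V) :
    LinearMap.BilinForm.baseChange ℂ (sumTranslates ρ B) x y =
      ∑ g, LinearMap.BilinForm.baseChange ℂ B ((ρ g).baseChange ℂ x) ((ρ g).baseChange ℂ y) := by
  induction x using TensorProduct.induction_on with
  | zero => simp
  | add x x' hx hx' => simp [hx, hx', Finset.sum_add_distrib]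
  | tmul z v =>
    induction y using TensorProduct.induction_on with
    | zero => simp
    | add y y' hy hy' => simp only [map_add, hy, hy', Finset.sum_add_distrib]
    | tmul w v' =>
      simp [LinearMap.BilinForm.baseChange_tmul, sumTranslates_apply, Algebra.smul_def,
        Finset.sum_mul]

lemma baseChange_sumTranslates_invariant (ρ : G →* (V →ₗ[ℚ] V)) (B : LinearMap.BilinForm ℚ V)
    (g : G) (x y : ℂ ⊗[ℚ] V) :
    LinearMap.BilinForm.baseChange ℂ (sumTranslates ρ B)
        ((ρ g).baseChange ℂ x) ((ρ g).baseChange ℂ y) =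
      LinearMap.BilinForm.baseChange ℂ (sumTranslates ρ B) x y := by
  simp only [baseChange_sumTranslates, baseChange_rep_mul]
  exact Fintype.sum_equiv (Equiv.mulRight g) _ _ fun _ => rfl

/-- Every finite group action preserves a positive definite symmetric rational bilinear form. -/
lemma exists_invariant_posDef [FiniteDimensional ℚ V] (ρ : G →* (V →ₗ[ℚ] V)) :
    ∃ S : LinearMap.BilinForm ℂ (ℂ ⊗[ℚ] V),
      (∀ x y, S x y = S y x) ∧
      (∀ x y, S (sigmaV V x) (sigmaV V y) = starRingEnd ℂ (S x y)) ∧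
      (∀ g x y, S ((ρ g).baseChange ℂ x) ((ρ g).baseChange ℂ y) = S x y) ∧
      (∀ x, x ≠ 0 → ∃ r : ℝ, 0 < r ∧ S x (sigmaV V x) = r) := by
  let b := Module.finBasis ℚ V
  refine ⟨LinearMap.BilinForm.baseChange ℂ (sumTranslates ρ (Matrix.toBilin b 1)), ?_,
    bilinForm_baseChange_sigmaV _, baseChange_sumTranslates_invariant ρ _, ?_⟩
  · intro x y
    simp only [baseChange_sumTranslates, baseChange_toBilin, Matrix.toBilin_apply]
    simp [Matrix.one_apply, apply_ite (Rat.cast : ℚ → ℂ), mul_comm]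
  · intro x hx
    have key : ∀ x : ℂ ⊗[ℚ] V, LinearMap.BilinForm.baseChange ℂ (Matrix.toBilin b 1) x
        (sigmaV V x) =
        ((∑ i, Complex.normSq ((b.baseChange ℂ).repr x i) : ℝ) : ℂ) := by
      intro x
      simp [baseChange_toBilin, Matrix.toBilin_apply, Matrix.one_apply, repr_sigmaV,
        Complex.mul_conj]
    refine ⟨∑ g, ∑ i, Complex.normSq ((b.baseChange ℂ).repr ((ρ g).baseChange ℂ x) i), ?_, ?_⟩
    · refine Finset.sum_pos (fun g _ => ?_) Finset.univ_nonempty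
      refine Finset.sum_pos' (fun i _ => Complex.normSq_nonneg _) ?_
      by_contra! h
      refine baseChange_rep_ne_zero ρ g hx ((b.baseChange ℂ).ext_elem fun i => ?_)
      simpa using le_antisymm (h i (Finset.mem_univ i)) (Complex.normSq_nonneg _)
    · simp only [baseChange_sumTranslates, ← sigmaV_baseChange, key, Complex.ofReal_sum]

end Average

section Rigid

variable {G : Type*} [Group G] [Fintype G] {V : Type*} [AddCommGroup V] [Module ℚ V]
  [FiniteDimensional ℚ V]

/-- Under rigidity, every invariant rational form is isotropic on `U`. -/
lemma baseChange_eq_zero_of_rigid (ρ : G →* (V →ₗ[ℚ] V)) (U : Submodule ℂ (ℂ ⊗[ℚ] V))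
    (hinv : ∀ g : G, ∀ x ∈ U, LinearMap.baseChange ℂ (ρ g) x ∈ U)
    (hrigid : ∀ f : sigmaSub U →ₗ[ℂ] U,
      (∀ g : G, CommutesWith (sigmaSub U) U f (LinearMap.baseChange ℂ (ρ g))) → f = 0)
    (E : LinearMap.BilinForm ℚ V)
    (hE : ∀ g x y, LinearMap.BilinForm.baseChange ℂ E ((ρ g).baseChange ℂ x)
      ((ρ g).baseChange ℂ y) = LinearMap.BilinForm.baseChange ℂ E x y)
    {u u' : ℂ ⊗[ℚ] V} (hu : u ∈ U) (hu' : u' ∈ U) :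
    LinearMap.BilinForm.baseChange ℂ E u u' = 0 := by
  obtain ⟨S, hsymm, -, hSinv, hpos⟩ := exists_invariant_posDef ρ
  have hinvσ : ∀ g : G, ∀ x ∈ sigmaSub U, LinearMap.baseChange ℂ (ρ g) x ∈ sigmaSub U := by
    intro g x hx
    have := sigmaV_mem_sigmaSub (hinv g _ (sigmaV_mem_of_mem_sigmaSub hx))
    rwa [sigmaV_baseChange, sigmaV_sigmaV] at this
  have hdef : ∀ x, S x (sigmaV V x) = 0 → x = 0 := by
    intro x hx
    by_contra hne
    obtain ⟨r, hr, hr'⟩ := hpos x hne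
    rw [hx] at hr'
    exact hr.ne (by exact_mod_cast hr')
  let p : U →ₗ[ℂ] sigmaSub U →ₗ[ℂ] ℂ := S.compl₁₂ U.subtype (sigmaSub U).subtype
  have hpair : p.IsPerfPair := by
    refine .of_injective ((injective_iff_map_eq_zero _).2 fun x hx => ?_)
      ((injective_iff_map_eq_zero _).2 fun y hy => ?_)
    · exact Subtype.ext (hdef x (LinearMap.congr_fun hx ⟨_, sigmaV_mem_sigmaSub x.2⟩))
    · refine Subtype.ext (hdef y ?_)
      rw [hsymm]
      exact LinearMap.congr_fun hy ⟨_, sigmaV_mem_of_mem_sigmaSub y.2⟩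
  let e : U ≃ₗ[ℂ] (sigmaSub U →ₗ[ℂ] ℂ) := LinearEquiv.ofBijective p hpair.bijective_left
  let f : sigmaSub U →ₗ[ℂ] U := e.symm.toLinearMap ∘ₗ
    (LinearMap.BilinForm.baseChange ℂ E).compl₁₂ (sigmaSub U).subtype (sigmaSub U).subtype
  have hf : ∀ y y' : sigmaSub U, S (f y) y' = LinearMap.BilinForm.baseChange ℂ E y y' :=
    fun y y' => LinearMap.congr_fun (e.apply_symm_apply _) y'
  have hf0 : f = 0 := by
    refine hrigid f fun g x hx => ?_
    have hTmem := hinv g _ (f x).2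
    suffices h : f ⟨_, hx⟩ = ⟨_, hTmem⟩ from congrArg Subtype.val h
    apply hpair.bijective_left.injective
    ext y
    have hy' : (ρ g).baseChange ℂ ((ρ g⁻¹).baseChange ℂ (y : ℂ ⊗[ℚ] V)) = y := by
      rw [baseChange_rep_mul, mul_inv_cancel, baseChange_rep_one]
    change S (f ⟨_, hx⟩) y = S ((ρ g).baseChange ℂ (f x)) y
    rw [hf, ← hy', hSinv, hE]
    exact (hf x ⟨_, hinvσ g⁻¹ _ y.2⟩).symm
  have h := hf ⟨_, sigmaV_mem_sigmaSub hu⟩ ⟨_, sigmaV_mem_sigmaSub hu'⟩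
  rw [hf0, bilinForm_baseChange_sigmaV] at h
  simpa using h.symm

end Rigid

/-- A strict inequality holding on a compact set for a real matrix also holds for a rational
one. -/
lemma exists_rat_matrix_pos {ι X : Type*} [Finite ι] [TopologicalSpace X] {K : Set X}
    (hK : IsCompact K) (F : Matrix ι ι ℝ → X → ℝ)
    (hF : Continuous fun z : Matrix ι ι ℝ × X => F z.1 z.2)
    {M : Matrix ι ι ℝ} (hM : ∀ x ∈ K, 0 < F M x) :
    ∃ N : Matrix ι ι ℚ, ∀ x ∈ K, 0 < F (N.map (fun q : ℚ => (q : ℝ))) x := by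
  have hev : ∀ᶠ M' in nhds M, ∀ x ∈ K, 0 < F M' x :=
    hK.eventually_forall_of_forall_eventually fun x hx =>
      hF.continuousAt.eventually_const_lt (hM x hx)
  have hdense : DenseRange fun (N : ι → ι → ℚ) i j => (N i j : ℝ) :=
    DenseRange.piMap fun _ => DenseRange.piMap fun _ => Rat.denseRange_cast
  obtain ⟨_, hN, ⟨N, rfl⟩⟩ := mem_closure_iff_nhds.1 (hdense M) _ hev
  exact ⟨N, hN⟩

section Positivity

variable {G : Type*} [Group G] [Fintype G] {V : Type*} [AddCommGroup V] [Module ℚ V]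

/-- The value at `(x, σ x)` of the invariant alternating form obtained from a bilinear form,
multiplied by `-i`. -/
def hermValue (ρ : G →* (V →ₗ[ℚ] V)) (B : LinearMap.BilinForm ℂ (ℂ ⊗[ℚ] V)) (x : ℂ ⊗[ℚ] V) : ℂ :=
  -Complex.I * ∑ g, (B ((ρ g).baseChange ℂ x) ((ρ g).baseChange ℂ (sigmaV V x)) -
    B ((ρ g).baseChange ℂ (sigmaV V x)) ((ρ g).baseChange ℂ x))

lemma hermValue_smul (ρ : G →* (V →ₗ[ℚ] V)) (B : LinearMap.BilinForm ℂ (ℂ ⊗[ℚ] V))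
    (t : ℝ) (x : ℂ ⊗[ℚ] V) : hermValue ρ B ((t : ℂ) • x) = ((t ^ 2 : ℝ) : ℂ) * hermValue ρ B x := by
  simp only [hermValue, LinearMap.map_smulₛₗ, map_smul, LinearMap.smul_apply, Complex.conj_ofReal,
    smul_eq_mul, Finset.mul_sum]
  refine Finset.sum_congr rfl fun g _ => ?_
  push_cast
  ring

lemma continuous_hermValue {ι : Type*} [Fintype ι] [DecidableEq ι] (b : Module.Basis ι ℚ V)
    (ρ : G →* (V →ₗ[ℚ] V)) :
    Continuous fun z : Matrix ι ι ℝ × (ι → ℂ) =>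
      (hermValue ρ (Matrix.toBilin (b.baseChange ℂ) (z.1.map (fun r : ℝ => (r : ℂ))))
        ((b.baseChange ℂ).equivFun.symm z.2)).re := by
  have hL : ∀ (g : G) (i : ι), Continuous fun c : ι → ℂ =>
      (b.baseChange ℂ).repr ((ρ g).baseChange ℂ ((b.baseChange ℂ).equivFun.symm c)) i := by
    intro g i
    exact ((b.baseChange ℂ).coord i ∘ₗ (ρ g).baseChange ℂ ∘ₗ
      (b.baseChange ℂ).equivFun.symm.toLinearMap).continuous_of_finiteDimensional
  have hM : ∀ i j, Continuous fun z : Matrix ι ι ℝ × (ι → ℂ) => (z.1 i j : ℂ) := fun i j =>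
    Complex.continuous_ofReal.comp (continuous_fst.matrix_elem i j)
  simp only [hermValue, Matrix.toBilin_apply, ← sigmaV_baseChange, repr_sigmaV, Matrix.map_apply]
  refine Complex.continuous_re.comp (continuous_const.mul (continuous_finsetSum _ fun g _ =>
    .sub ?_ ?_)) <;>
  refine continuous_finsetSum _ fun i _ => continuous_finsetSum _ fun j _ => ?_
  · exact (((hL g i).comp continuous_snd).mul (hM i j)).mul
      (Complex.continuous_conj.comp ((hL g j).comp continuous_snd))
  · exact ((Complex.continuous_conj.comp ((hL g i).comp continuous_snd)).mul (hM i j)).mul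
      ((hL g j).comp continuous_snd)

/-- An invariant Hodge structure of weight one has a real form inducing a positive definite
Hermitian form on `U`. -/
lemma exists_real_hermValue_pos [FiniteDimensional ℚ V] (ρ : G →* (V →ₗ[ℚ] V))
    (U : Submodule ℂ (ℂ ⊗[ℚ] V))
    (hinv : ∀ g : G, ∀ x ∈ U, LinearMap.baseChange ℂ (ρ g) x ∈ U)
    (hcompl : IsCompl U (sigmaSub U)) :
    ∃ B : LinearMap.BilinForm ℂ (ℂ ⊗[ℚ] V),
      (∀ x y, B (sigmaV V x) (sigmaV V y) = starRingEnd ℂ (B x y)) ∧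
      ∀ u ∈ U, u ≠ 0 → 0 < (hermValue ρ B u).re := by
  obtain ⟨S, hsymm, hconj, -, hpos⟩ := exists_invariant_posDef ρ
  let P := U.projection (sigmaSub U) hcompl
  let Q := (sigmaSub U).projection U hcompl.symm
  have hP : ∀ x, sigmaV V (P x) = Q (sigmaV V x) := sigmaV_projection hcompl
  have hQ : ∀ x, sigmaV V (Q x) = P (sigmaV V x) := by
    intro x
    rw [← sigmaV_sigmaV (P (sigmaV V x)), hP, sigmaV_sigmaV]
  let B : LinearMap.BilinForm ℂ (ℂ ⊗[ℚ] V) :=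
    Complex.I • (S.compl₁₂ P Q - S.compl₁₂ Q P)
  have hB : ∀ x y, B x y = Complex.I * (S (P x) (Q y) - S (Q x) (P y)) := fun x y => by simp [B]
  refine ⟨B, fun x y => ?_, fun u hu hne => ?_⟩
  · rw [hB, hB, ← hP, ← hQ, ← hP, ← hQ, hconj, hconj]
    simp only [map_mul, map_sub, Complex.conj_I]
    ring
  · have hterm : ∀ v ∈ U, B v (sigmaV V v) - B (sigmaV V v) v =
        2 * Complex.I * S v (sigmaV V v) := by
      intro v hv
      have hPv : P v = v := Submodule.projection_apply_of_mem_left _ hv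
      have hQv : Q v = 0 := Submodule.projection_apply_of_mem_right _ hv
      have hPσ : P (sigmaV V v) = 0 := by rw [← hQ, hQv, map_zero]
      have hQσ : Q (sigmaV V v) = sigmaV V v := by rw [← hP, hPv]
      simp only [hB, hPv, hQv, hPσ, hQσ, map_zero]
      rw [hsymm (sigmaV V v) v]
      ring
    rw [hermValue, Finset.mul_sum, Complex.re_sum]
    refine Finset.sum_pos (fun g _ => ?_) Finset.univ_nonempty
    obtain ⟨r, hr, hr'⟩ := hpos _ (baseChange_rep_ne_zero ρ g hne)
    rw [← sigmaV_baseChange, hterm _ (hinv g u hu), hr']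
    have : -Complex.I * (2 * Complex.I * (r : ℂ)) = ((2 * r : ℝ) : ℂ) := by
      push_cast
      linear_combination (-2 * (r : ℂ)) * Complex.I_mul_I
    rw [this, Complex.ofReal_re]
    positivity

/-- An invariant Hodge structure of weight one has a rational form inducing a positive definite
Hermitian form on `U`. -/
lemma exists_rat_hermValue_pos [FiniteDimensional ℚ V] (ρ : G →* (V →ₗ[ℚ] V))
    (U : Submodule ℂ (ℂ ⊗[ℚ] V))
    (hinv : ∀ g : G, ∀ x ∈ U, LinearMap.baseChange ℂ (ρ g) x ∈ U)
    (hcompl : IsCompl U (sigmaSub U)) :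
    ∃ B : LinearMap.BilinForm ℚ V,
      ∀ u ∈ U, u ≠ 0 → 0 < (hermValue ρ (LinearMap.BilinForm.baseChange ℂ B) u).re := by
  obtain ⟨B, hconj, hpos⟩ := exists_real_hermValue_pos ρ U hinv hcompl
  let b := Module.finBasis ℚ V
  let e := (b.baseChange ℂ).equivFun
  obtain ⟨M, rfl⟩ := eq_toBilin_of_conj b B hconj
  let K := Metric.sphere (0 : Fin (Module.finrank ℚ V) → ℂ) 1 ∩
    (U.comap e.symm.toLinearMap : Submodule ℂ _)
  have hK : IsCompact K :=
    (isCompact_sphere _ _).inter_right (Submodule.closed_of_finiteDimensional _)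
  obtain ⟨N, hN⟩ := exists_rat_matrix_pos hK (fun M c => (hermValue ρ (Matrix.toBilin
    (b.baseChange ℂ) (M.map fun r : ℝ => (r : ℂ))) (e.symm c)).re)
    (continuous_hermValue b ρ) (M := M) (by
    rintro c ⟨hc, hcU⟩
    refine hpos _ hcU ((map_ne_zero_iff _ e.symm.injective).2 ?_)
    exact ne_zero_of_mem_unit_sphere ⟨c, hc⟩)
  refine ⟨Matrix.toBilin b N, fun u hu hne => ?_⟩
  have hnorm : 0 < ‖e u‖ := norm_pos_iff.2 ((map_ne_zero_iff _ e.injective).2 hne)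
  have hsymm : (b.baseChange ℂ).equivFun.symm (((‖e u‖⁻¹ : ℝ) : ℂ) • e u) =
      ((‖e u‖⁻¹ : ℝ) : ℂ) • u := by
    rw [map_smul]
    exact congrArg _ (e.symm_apply_apply u)
  have hmem : (b.baseChange ℂ).equivFun.symm (((‖e u‖⁻¹ : ℝ) : ℂ) • e u) ∈ U :=
    hsymm ▸ U.smul_mem _ hu
  have h := hN (((‖e u‖⁻¹ : ℝ) : ℂ) • e u) ⟨by simp [norm_smul, hnorm.ne'], hmem⟩
  rw [hsymm, hermValue_smul, Complex.re_ofReal_mul] at h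
  have hmap : (N.map fun q : ℚ => (q : ℝ)).map (fun r : ℝ => (r : ℂ)) =
      N.map fun q : ℚ => (q : ℂ) := by
    ext; simp
  rw [hmap, ← baseChange_toBilin] at h
  exact pos_of_mul_pos_right h (by positivity)

end Positivity

/-- **Ekedahl's theorem** (Hodge-theoretic form): a rigid action of a finite group on
a weight-one rational Hodge structure forces the Hodge structure to be polarizable. -/
theorem rigid_group_action_polarizable
    (G : Type*) [Group G] [Finite G]
    (V : Type*) [AddCommGroup V] [Module ℚ V] [FiniteDimensional ℚ V]
    (ρ : G →* (V →ₗ[ℚ] V))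
    (U : Submodule ℂ (ℂ ⊗[ℚ] V))
    (hinv : ∀ g : G, ∀ x ∈ U, LinearMap.baseChange ℂ (ρ g) x ∈ U)
    (hcompl : IsCompl U (sigmaSub U))
    (hrigid : ∀ f : sigmaSub U →ₗ[ℂ] U,
      (∀ g : G, CommutesWith (sigmaSub U) U f (LinearMap.baseChange ℂ (ρ g))) → f = 0) :
    ∃ E : V →ₗ[ℚ] V →ₗ[ℚ] ℚ, IsPolarization U E := by
  have := Fintype.ofFinite G
  obtain ⟨B, hB⟩ := exists_rat_hermValue_pos ρ U hinv hcompl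
  let E : LinearMap.BilinForm ℚ V := sumTranslates ρ (B - B.flip)
  have halt : ∀ x, E x x = 0 := fun x => by simp [E, sumTranslates_apply]
  have hEx : ∀ x y, LinearMap.BilinForm.baseChange ℂ E x y =
      ∑ g, (LinearMap.BilinForm.baseChange ℂ B ((ρ g).baseChange ℂ x) ((ρ g).baseChange ℂ y) -
        LinearMap.BilinForm.baseChange ℂ B ((ρ g).baseChange ℂ y) ((ρ g).baseChange ℂ x)) := by
    intro x y
    simp only [E, baseChange_sumTranslates, baseChange_sub_flip]
  refine ⟨E, halt, fun u hu u' hu' => baseChange_eq_zero_of_rigid ρ U hinv hrigid E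
    (baseChange_sumTranslates_invariant ρ _) hu hu', fun u hu hne => ?_⟩
  have hval : -Complex.I * LinearMap.BilinForm.baseChange ℂ E u (sigmaV V u) =
      hermValue ρ (LinearMap.BilinForm.baseChange ℂ B) u := by
    rw [hEx, hermValue]
  refine ⟨_, hB u hu hne, ?_⟩
  rw [hval]
  refine (Complex.conj_eq_iff_re.1 ?_).symm
  rw [← hval, map_mul, ← bilinForm_baseChange_sigmaV, sigmaV_sigmaV, hEx, hEx, map_neg,
    Complex.conj_I, neg_neg, ← neg_mul_neg Complex.I, ← Finset.sum_neg_distrib]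
  simp only [neg_sub]

end
end

section
/- Let G be a finite group. The center Z(ℚ[G]) of the rational group algebra ℚ[G] is isomorphic as a ℚ-algebra to a finite product F₁ × ⋯ × F_l of number fields, each of which is either totally real or a CM-field. -/
/-- A field is totally real if every ring homomorphism to `ℂ` has image in `ℝ`. -/
def IsTotallyRealField (F : Type*) [Field F] : Prop :=
  ∀ σ : F →+* ℂ, ∀ x : F, ∃ r : ℝ, σ x = (r : ℂ)

/-- A field is totally imaginary if it admits no real embedding. -/
def IsTotallyImaginary (F : Type*) [Field F] : Prop :=
  IsEmpty (F →+* ℝ)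

/-- A number field is a CM-field if it is totally imaginary and is a quadratic
extension of a totally real subfield. -/
def IsCMField (F : Type*) [Field F] : Prop :=
  IsTotallyImaginary F ∧
    ∃ K : Subfield F, IsTotallyRealField K ∧ Module.finrank K F = 2

/-- A CM-type on `F`: a set of embeddings `F → ℂ` containing exactly one of each
conjugate pair. -/
def IsCMType (F : Type*) [Field F] (Φ : Set (F →+* ℂ)) : Prop :=
  ∀ σ : F →+* ℂ, Xor' (σ ∈ Φ) (σ ∈ (fun τ : F →+* ℂ => (starRingEnd ℂ).comp τ) '' Φ)

/-- A field with an endomorphism inducing complex conjugation under every complex embedding is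
totally real or CM. -/
theorem isTotallyRealField_or_isCMField_of_conj {F : Type*} [Field F] [CharZero F]
    [Algebra.IsAlgebraic ℚ F] (c : F →+* F)
    (hc : ∀ (σ : F →+* ℂ) (x : F), σ (c x) = starRingEnd ℂ (σ x)) :
    IsTotallyRealField F ∨ IsCMField F := by
  by_cases hid : ∀ x, c x = x
  · left
    intro σ x
    have h := hc σ x
    rw [hid] at h
    exact ⟨(σ x).re, (Complex.conj_eq_iff_re.mp h.symm).symm⟩
  right
  push Not at hid
  obtain ⟨x₀, hx₀⟩ := hid
  refine ⟨⟨fun ρ => hx₀ ?_⟩, RingHom.eqLocusField c (RingHom.id F), ?_, ?_⟩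
  · have h := hc ((algebraMap ℝ ℂ).comp ρ) x₀
    refine ((algebraMap ℝ ℂ).comp ρ).injective ?_
    rw [h]
    exact Complex.conj_ofReal _
  · intro τ x
    let : Algebra (RingHom.eqLocusField c (RingHom.id F)) ℂ := τ.toAlgebra
    have : Algebra.IsAlgebraic (RingHom.eqLocusField c (RingHom.id F)) F :=
      Algebra.IsAlgebraic.tower_top (K := ℚ) _
    let σ : F →ₐ[RingHom.eqLocusField c (RingHom.id F)] ℂ := IsAlgClosed.lift
    have hx : c (x : F) = x := x.2
    have h := hc σ.toRingHom x
    rw [hx] at h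
    have hσ : σ.toRingHom (x : F) = τ x := σ.commutes x
    rw [hσ] at h
    exact ⟨(τ x).re, (Complex.conj_eq_iff_re.mp h.symm).symm⟩
  · obtain ⟨σ⟩ : Nonempty (F →+* ℂ) := ⟨(IsAlgClosed.lift : F →ₐ[ℚ] ℂ).toRingHom⟩
    have hcc : ∀ x, c (c x) = x := fun x => σ.injective (by simp [hc])
    set K := RingHom.eqLocusField c (RingHom.id F)
    set d := x₀ - c x₀ with hd
    have hd0 : d ≠ 0 := sub_ne_zero.mpr (Ne.symm hx₀)
    have hcd : c d = -d := by simp [hd, hcc]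
    have hmem : ∀ y : F, c y = y → y ∈ K := fun y hy => hy
    have hli : LinearIndependent K ![(1 : F), d] := by
      rw [LinearIndependent.pair_iff]
      intro s t hst
      simp only [Subfield.smul_def, smul_eq_mul, mul_one] at hst
      have hs : c (s : F) = s := s.2
      have ht : c (t : F) = t := t.2
      have hst' := congrArg c hst
      simp only [map_add, map_mul, hs, ht, hcd, map_zero] at hst'
      have hs0 : (s : F) = 0 := by linear_combination (1 / 2 : F) * hst + (1 / 2 : F) * hst'
      have ht0 : (t : F) = 0 := by
        rw [hs0, zero_add] at hst
        exact (mul_eq_zero.mp hst).resolve_right hd0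
      exact ⟨Subtype.ext hs0, Subtype.ext ht0⟩
    have hspan : ⊤ ≤ Submodule.span K (Set.range ![(1 : F), d]) := by
      intro y _
      simp only [Matrix.range_cons, Matrix.range_empty, Set.union_empty, Set.singleton_union]
      rw [Submodule.mem_span_pair]
      refine ⟨⟨(y + c y) / 2, hmem _ ?_⟩, ⟨(y - c y) / (2 * d), hmem _ ?_⟩, ?_⟩
      · rw [map_div₀, map_add, hcc, map_ofNat, add_comm]
      · simp only [map_div₀, map_sub, map_mul, hcc, hcd, map_ofNat]
        field_simp
        ring
      · simp only [Subfield.smul_def, smul_eq_mul]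
        field_simp
        ring
    simpa using Module.finrank_eq_card_basis (Module.Basis.mk hli hspan)

/-- A central element with square zero in a semisimple ring vanishes. -/
theorem IsSemisimpleRing.eq_zero_of_sq_eq_zero_of_commute {R : Type*} [Ring R]
    [IsSemisimpleRing R] {x : R} (hx : ∀ y, Commute x y) (h : x ^ 2 = 0) : x = 0 := by
  obtain ⟨e, he, hspan⟩ := IsSemisimpleRing.ideal_eq_span_idempotent (Ideal.span {x})
  have hex : e ∈ Ideal.span {x} := hspan ▸ Ideal.mem_span_singleton_self e
  have hxe : x ∈ Ideal.span {e} := hspan ▸ Ideal.mem_span_singleton_self x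
  obtain ⟨a, rfl⟩ := Ideal.mem_span_singleton'.mp hex
  obtain ⟨b, hb⟩ := Ideal.mem_span_singleton'.mp hxe
  have : a * x = 0 := by
    rw [← he.eq, mul_assoc, ← mul_assoc x, (hx a).eq, mul_assoc a, ← sq, h]
    simp
  rw [← hb, this, mul_zero]

instance MonoidAlgebra.isReduced_center {k G : Type*} [Field k] [CharZero k] [Group G]
    [Finite G] : IsReduced (Subalgebra.center k (MonoidAlgebra k G)) := by
  have : NeZero (Nat.card G : k) := ⟨Nat.cast_ne_zero.mpr Nat.card_pos.ne'⟩
  refine (isReduced_iff_pow_one_lt 2 one_lt_two).mpr fun x hx => Subtype.ext ?_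
  exact IsSemisimpleRing.eq_zero_of_sq_eq_zero_of_commute
    (fun y => ((Subalgebra.mem_center_iff.mp x.2) y).symm) (congrArg Subtype.val hx)

namespace MonoidAlgebra

variable {G : Type*} [Group G]

/-- The canonical anti-involution of a group algebra, inverting group elements. -/
noncomputable def invOp (k G : Type*) [CommSemiring k] [Group G] :
    MonoidAlgebra k G →ₐ[k] (MonoidAlgebra k G)ᵐᵒᵖ :=
  MonoidAlgebra.lift k (MonoidAlgebra k G)ᵐᵒᵖ G
    { toFun := fun g => MulOpposite.op (MonoidAlgebra.of k G g⁻¹)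
      map_one' := by simp [MonoidAlgebra.one_def]
      map_mul' := fun g h => by rw [← MulOpposite.op_mul, ← map_mul, mul_inv_rev] }

theorem unop_invOp_single {k : Type*} [CommSemiring k] (g : G) (r : k) :
    (invOp k G (single g r)).unop = single g⁻¹ r := by
  simp [invOp, MonoidAlgebra.lift_single]

theorem unop_invOp_unop_invOp {k : Type*} [CommSemiring k] (x : MonoidAlgebra k G) :
    (invOp k G (invOp k G x).unop).unop = x := by
  induction x using MonoidAlgebra.induction_linear with
  | zero => simp
  | add x y hx hy => simp [hx, hy]
  | single g r => simp [unop_invOp_single]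

theorem unop_invOp_mem_center {k : Type*} [CommSemiring k] {x : MonoidAlgebra k G}
    (hx : x ∈ Subalgebra.center k (MonoidAlgebra k G)) :
    (invOp k G x).unop ∈ Subalgebra.center k (MonoidAlgebra k G) := by
  rw [Subalgebra.mem_center_iff] at hx ⊢
  intro y
  have h := congrArg (fun z => (invOp k G z).unop) (hx (invOp k G y).unop)
  simpa [unop_invOp_unop_invOp] using h.symm

/-- Inversion of group elements on the center of the group algebra. -/
noncomputable def centerInv {k : Type*} [CommSemiring k]
    (x : Subalgebra.center k (MonoidAlgebra k G)) : Subalgebra.center k (MonoidAlgebra k G) :=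
  ⟨(invOp k G x).unop, unop_invOp_mem_center x.2⟩

theorem leftMulMatrix_unop_invOp {k : Type*} [CommRing k] [Fintype G] [DecidableEq G]
    (x : MonoidAlgebra k G) :
    Algebra.leftMulMatrix (MonoidAlgebra.basis G k) (invOp k G x).unop =
      (Algebra.leftMulMatrix (MonoidAlgebra.basis G k) x).transpose := by
  induction x using MonoidAlgebra.induction_linear with
  | zero => simp
  | add x y hx hy => simp [hx, hy]
  | single g r =>
    ext i j
    rw [unop_invOp_single, Matrix.transpose_apply]
    simp only [Algebra.leftMulMatrix_eq_repr_mul, MonoidAlgebra.basis_apply, single_mul_single,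
      mul_one]
    simp [MonoidAlgebra.basis, Finsupp.single_apply, eq_inv_mul_iff_mul_eq, eq_comm]

end MonoidAlgebra

/-- The spectrum of a Hermitian matrix is real. -/
theorem Matrix.IsHermitian.conj_eq_of_mem_spectrum {n : Type*} [Fintype n] [DecidableEq n]
    {A : Matrix n n ℂ} (hA : A.IsHermitian) {μ : ℂ} (hμ : μ ∈ spectrum ℂ A) :
    starRingEnd ℂ μ = μ := by
  rw [hA.spectrum_eq_image_range] at hμ
  obtain ⟨r, -, rfl⟩ := hμ
  exact Complex.conj_ofReal r

/-- The spectrum of a skew-Hermitian matrix is purely imaginary. -/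
theorem Matrix.conj_eq_neg_of_mem_spectrum {n : Type*} [Fintype n] [DecidableEq n]
    {A : Matrix n n ℂ} (hA : A.conjTranspose = -A) {μ : ℂ} (hμ : μ ∈ spectrum ℂ A) :
    starRingEnd ℂ μ = -μ := by
  have hH : (Complex.I • A).IsHermitian := by
    simp [Matrix.IsHermitian, Matrix.conjTranspose_smul, hA]
  have hmem : Complex.I * μ ∈ spectrum ℂ (Complex.I • A) := by
    have := (spectrum.smul_mem_smul_iff (r := Units.mk0 Complex.I Complex.I_ne_zero)).mpr hμ
    simpa [Units.smul_def] using this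
  have h := hH.conj_eq_of_mem_spectrum hmem
  rw [map_mul, Complex.conj_I] at h
  refine mul_left_cancel₀ Complex.I_ne_zero ?_
  linear_combination -h

/-- A character of a subalgebra of a matrix-represented algebra takes spectral values. -/
theorem Algebra.map_mem_spectrum_leftMulMatrix {k L A B ι : Type*} [Field k] [Field L]
    [Algebra k L] [CommRing B] [Algebra k B] [Ring A] [Algebra k A] [Fintype ι] [DecidableEq ι]
    (b : Module.Basis ι k A) (i : B →ₐ[k] A) (hi : Function.Injective i)
    (φ : B →ₐ[k] L) (x : B) :
    φ x ∈ spectrum L ((Algebra.leftMulMatrix b (i x)).map (algebraMap k L)) := by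
  rw [Matrix.mem_spectrum_iff_isRoot_charpoly, Matrix.charpoly_map, Polynomial.IsRoot.def,
    Polynomial.eval_map_algebraMap, Polynomial.aeval_algHom_apply]
  have h : Polynomial.aeval x (Algebra.leftMulMatrix b (i x)).charpoly = 0 := by
    apply hi
    apply Algebra.leftMulMatrix_injective b
    rw [← Polynomial.aeval_algHom_apply, ← Polynomial.aeval_algHom_apply,
      Matrix.aeval_self_charpoly, map_zero, map_zero]
  rw [h, map_zero]

/-- Every complex character of the center of `ℚ[G]` intertwines inversion of group elements with
complex conjugation. -/
theorem MonoidAlgebra.map_centerInv {G : Type*} [Group G] [Finite G]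
    (φ : Subalgebra.center ℚ (MonoidAlgebra ℚ G) →ₐ[ℚ] ℂ)
    (x : Subalgebra.center ℚ (MonoidAlgebra ℚ G)) :
    φ (centerInv x) = starRingEnd ℂ (φ x) := by
  classical
  have := Fintype.ofFinite G
  have hspec := Algebra.map_mem_spectrum_leftMulMatrix (MonoidAlgebra.basis G ℚ)
    (Subalgebra.center ℚ (MonoidAlgebra ℚ G)).val Subtype.val_injective φ
  have hadj : ∀ M : Matrix G G ℚ, (M.map (algebraMap ℚ ℂ)).conjTranspose =
      M.transpose.map (algebraMap ℚ ℂ) := fun M => by ext i j; simp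
  have hinv := leftMulMatrix_unop_invOp (k := ℚ) (x : MonoidAlgebra ℚ G)
  have hinv' := congrArg Matrix.transpose hinv
  rw [Matrix.transpose_transpose] at hinv'
  have hre := Matrix.IsHermitian.conj_eq_of_mem_spectrum (by
    rw [Matrix.IsHermitian, hadj]
    congr 1
    simp only [map_add, Matrix.transpose_add]
    rw [add_comm]
    exact congrArg₂ (· + ·) hinv' hinv.symm) (hspec (x + centerInv x))
  have him := Matrix.conj_eq_neg_of_mem_spectrum (by
    rw [hadj, ← Matrix.map_neg _ (map_neg _)]
    congr 1
    simp only [map_sub, Matrix.transpose_sub, neg_sub]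
    exact congrArg₂ (· - ·) hinv.symm hinv') (hspec (x - centerInv x))
  simp only [map_add, map_sub] at hre him
  linear_combination (-1 / 2 : ℂ) * hre - (1 / 2 : ℂ) * him

/-- The image of the center of `ℚ[G]` in `ℂ` under a homomorphism is totally real or CM. -/
theorem MonoidAlgebra.fieldRange_isTotallyRealField_or_isCMField {G : Type*} [Group G] [Finite G]
    (E : IntermediateField ℚ ℂ) [Algebra.IsAlgebraic ℚ E]
    (π : Subalgebra.center ℚ (MonoidAlgebra ℚ G) →ₐ[ℚ] E) (hπ : Function.Surjective π) :
    IsTotallyRealField E ∨ IsCMField E := by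
  have hE : ∀ z : E, starRingEnd ℂ (z : ℂ) ∈ E := fun z => by
    obtain ⟨x, rfl⟩ := hπ z
    have h := map_centerInv (E.val.comp π) x
    exact h ▸ (π (centerInv x)).2
  let c : E →+* E := ((starRingEnd ℂ).comp E.val.toRingHom).codRestrict E hE
  refine isTotallyRealField_or_isCMField_of_conj c fun σ z => ?_
  obtain ⟨x, rfl⟩ := hπ z
  have hc : c (π x) = π (centerInv x) := Subtype.ext (map_centerInv (E.val.comp π) x).symm
  rw [hc]
  exact map_centerInv (σ.toRatAlgHom.comp π) x

/-- A finite-dimensional reduced commutative `ℚ`-algebra is a finite product of number fields,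
realized inside `ℂ`. -/
theorem exists_algEquiv_pi_intermediateField_complex (A : Type*) [CommRing A] [Algebra ℚ A]
    [FiniteDimensional ℚ A] [IsReduced A] :
    ∃ (l : ℕ) (E : Fin l → IntermediateField ℚ ℂ), (∀ i, FiniteDimensional ℚ (E i)) ∧
      Nonempty (A ≃ₐ[ℚ] ((i : Fin l) → E i)) := by
  have : IsArtinianRing A := IsArtinianRing.of_finite ℚ A
  let (I : MaximalSpectrum A) : Field (A ⧸ I.asIdeal) := Ideal.Quotient.field I.asIdeal
  have (I : MaximalSpectrum A) : FiniteDimensional ℚ (A ⧸ I.asIdeal) := inferInstance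
  let ψ (I : MaximalSpectrum A) : (A ⧸ I.asIdeal) →ₐ[ℚ] ℂ := IsAlgClosed.lift
  let E (I : MaximalSpectrum A) : IntermediateField ℚ ℂ := (ψ I).fieldRange
  let ε (I : MaximalSpectrum A) : (A ⧸ I.asIdeal) ≃ₐ[ℚ] E I := (ψ I).equivFieldRange
  let e : MaximalSpectrum A ≃ Fin (Nat.card (MaximalSpectrum A)) := Finite.equivFin _
  refine ⟨_, fun i => E (e.symm i), fun i => Module.Finite.equiv (ε (e.symm i)).toLinearEquiv, ⟨?_⟩⟩
  exact ((IsArtinianRing.equivPi A).restrictScalars ℚ).trans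
    ((AlgEquiv.piCongrRight ε).trans (AlgEquiv.piCongrLeft ℚ (fun I => E I) e.symm).symm)

/-- The center of the rational group algebra of a finite group is, as a `ℚ`-algebra,
a finite product of number fields, each either totally real or a CM-field. -/
theorem center_rat_group_algebra_isom_product_of_CM_or_totallyReal_fields
    (G : Type*) [Group G] [Fintype G] :
    ∃ (l : ℕ) (F : Fin l → Type) (instF : ∀ i, Field (F i)),
      (∀ i, letI := instF i; NumberField (F i)) ∧
      (∀ i, letI := instF i; IsTotallyRealField (F i) ∨ IsCMField (F i)) ∧
      (letI := instF;
        ∃ _ : ∀ i, Algebra ℚ (F i),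
          Nonempty (Subalgebra.center ℚ (MonoidAlgebra ℚ G) ≃ₐ[ℚ] ((i : Fin l) → F i))) := by
  have : FiniteDimensional ℚ (MonoidAlgebra ℚ G) :=
    Module.Finite.of_basis (MonoidAlgebra.basis G ℚ)
  obtain ⟨l, E, hE, ⟨e⟩⟩ := exists_algEquiv_pi_intermediateField_complex
    (Subalgebra.center ℚ (MonoidAlgebra ℚ G))
  refine ⟨l, fun i => E i, fun i => inferInstance, fun i => ?_, fun i => ?_,
    fun i => inferInstance, ⟨e⟩⟩
  · exact { to_charZero := inferInstance, to_finiteDimensional := inferInstance }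
  · exact MonoidAlgebra.fieldRange_isTotallyRealField_or_isCMField (E i)
      ((Pi.evalAlgHom ℚ (fun i => E i) i).comp e.toAlgHom)
      ((Function.surjective_eval i).comp e.surjective)
end
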